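/- There exists a smooth immersion γ : S¹ → ℝ² whose Gauss map G(x) = dγ(x)(∂_θ)/‖dγ(x)(∂_θ)‖ has degree 1, but which does not extend to an immersion of the closed disc: there is no immersion f : D² → ℝ² with f|_{∂D²} = γ (after identifying ∂D² with S¹). -/

import Mathlib

open Real Function

noncomputable section

/-- A `C¹` immersion of the circle `S¹ = ℝ/2πℤ` into the plane, represented by a
`2π`-periodic `C¹` map `γ : ℝ → ℝ²` with nowhere-vanishing derivative. -/
def IsCircleImmersion (γ : ℝ → ℝ × ℝ) : Prop :=
  ContDiff ℝ 1 γ ∧ (∀ t, γ (t + 2 * π) = γ t) ∧ ∀ t, deriv γ t ≠ 0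

/-- The Gauss map of `γ` has degree `d`, expressed by a continuous angle lift. -/
def GaussMapHasDegree (γ : ℝ → ℝ × ℝ) (d : ℤ) : Prop :=
  ∃ θ : ℝ → ℝ, Continuous θ ∧
    (∀ t, ∃ r : ℝ, 0 < r ∧ deriv γ t = r • (cos (θ t), sin (θ t))) ∧
    θ (2 * π) - θ 0 = d * (2 * π)

/-- The closed unit disc `D² ⊆ ℝ²`. -/
def Disc : Set (ℝ × ℝ) := {q : ℝ × ℝ | q.1 ^ 2 + q.2 ^ 2 ≤ 1}

/-- `γ` (a circle immersion) extends to an immersion of the closed disc: there is a map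
`f`, `C¹` on a neighbourhood `U` of `D²`, whose differential is injective at every point
of `D²`, and which restricts to `γ` on the boundary circle (identifying `∂D²` with `S¹`
via `t ↦ (cos t, sin t)`). -/
def ExtendsToDiscImmersion (γ : ℝ → ℝ × ℝ) : Prop :=
  ∃ (f : ℝ × ℝ → ℝ × ℝ) (U : Set (ℝ × ℝ)), IsOpen U ∧ Disc ⊆ U ∧
    ContDiffOn ℝ 1 f U ∧ (∀ q ∈ Disc, Injective (fderiv ℝ f q)) ∧
    ∀ t : ℝ, f (cos t, sin t) = γ t

/-- The limaçon-like curve with velocity `(8 sin t (4 cos t + 1), 1 + 2 cos t - 2 cos² t)`. -/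
def doubleLoop (t : ℝ) : ℝ × ℝ := (-(4 * cos t + 1) ^ 2, sin t * (2 - cos t))

/-- The velocity of `doubleLoop`. -/
def doubleLoopVelocity (t : ℝ) : ℝ × ℝ :=
  (8 * sin t * (4 * cos t + 1), 1 + 2 * cos t - 2 * cos t ^ 2)

/-- The velocity of `doubleLoop` as a complex number, divided by `i * exp (i * t)`. -/
def doubleLoopRotated (t : ℝ) : ℂ :=
  ⟨-sin t * (doubleLoopVelocity t).1 + cos t * (doubleLoopVelocity t).2,
    -cos t * (doubleLoopVelocity t).1 - sin t * (doubleLoopVelocity t).2⟩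

theorem contDiff_doubleLoop {n : WithTop ℕ∞} : ContDiff ℝ n doubleLoop := by
  unfold doubleLoop
  have hc : ContDiff ℝ n cos := contDiff_cos
  have hs : ContDiff ℝ n sin := contDiff_sin
  fun_prop

theorem doubleLoop_periodic (t : ℝ) : doubleLoop (t + 2 * π) = doubleLoop t := by
  simp [doubleLoop]

theorem hasDerivAt_doubleLoop (t : ℝ) :
    HasDerivAt doubleLoop (doubleLoopVelocity t) t := by
  have h₁ := ((((hasDerivAt_cos t).const_mul 4).add_const 1).pow 2).neg
  have h₂ := (hasDerivAt_sin t).mul ((hasDerivAt_cos t).const_sub 2)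
  refine (h₁.prodMk h₂).congr_deriv (Prod.ext ?_ ?_)
  · simp only [doubleLoopVelocity]
    push_cast
    ring
  · simp only [doubleLoopVelocity]
    linear_combination sin_sq_add_cos_sq t

theorem continuous_doubleLoopRotated : Continuous doubleLoopRotated := by
  refine Complex.equivRealProdCLM.symm.continuous.comp (?_ : Continuous fun t =>
    ((doubleLoopRotated t).re, (doubleLoopRotated t).im))
  simp only [doubleLoopRotated, doubleLoopVelocity]
  fun_prop

theorem doubleLoopRotated_mem_slitPlane (t : ℝ) : doubleLoopRotated t ∈ Complex.slitPlane := by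
  rw [Complex.mem_slitPlane_iff]
  by_cases hs : sin t = 0
  · left
    have hc : (cos t - 1) * (cos t + 1) = 0 := by nlinarith [sin_sq_add_cos_sq t]
    simp only [doubleLoopRotated, doubleLoopVelocity, hs]
    rcases mul_eq_zero.1 hc with h | h
    · rw [show cos t = 1 by linarith]; norm_num
    · rw [show cos t = -1 by linarith]; norm_num
  · right
    have h : (doubleLoopRotated t).im = -(sin t * (30 * cos t ^ 2 + 10 * cos t + 1)) := by
      simp only [doubleLoopRotated, doubleLoopVelocity]
      ring
    rw [h]
    exact neg_ne_zero.2 (mul_ne_zero hs (by nlinarith [sq_nonneg (6 * cos t + 1)]))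

theorem gaussMapHasDegree_doubleLoop : GaussMapHasDegree doubleLoop 1 := by
  refine ⟨fun t => t + π / 2 + (doubleLoopRotated t).arg, ?_, fun t => ?_, ?_⟩
  · exact (continuous_id.add continuous_const).add <| continuous_iff_continuousAt.2 fun t =>
      (Complex.continuousAt_arg (doubleLoopRotated_mem_slitPlane t)).comp
        continuous_doubleLoopRotated.continuousAt
  · refine ⟨‖doubleLoopRotated t‖,
      norm_pos_iff.2 (Complex.slitPlane_ne_zero (doubleLoopRotated_mem_slitPlane t)), ?_⟩
    have hre := Complex.norm_mul_cos_arg (doubleLoopRotated t)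
    have him := Complex.norm_mul_sin_arg (doubleLoopRotated t)
    have hsc := sin_sq_add_cos_sq t
    rw [(hasDerivAt_doubleLoop t).deriv]
    refine Prod.ext ?_ ?_
    · simp only [Prod.smul_fst, smul_eq_mul, cos_add, sin_add, cos_pi_div_two, sin_pi_div_two]
      simp only [doubleLoopRotated] at hre him ⊢
      linear_combination sin t * hre + cos t * him - (doubleLoopVelocity t).1 * hsc
    · simp only [Prod.smul_snd, smul_eq_mul, cos_add, sin_add, cos_pi_div_two, sin_pi_div_two]
      simp only [doubleLoopRotated] at hre him ⊢
      linear_combination -cos t * hre + sin t * him - (doubleLoopVelocity t).2 * hsc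
  · simp [doubleLoopRotated, doubleLoopVelocity]

theorem deriv_doubleLoop_ne_zero (t : ℝ) : deriv doubleLoop t ≠ 0 := by
  rw [(hasDerivAt_doubleLoop t).deriv]
  intro h
  apply Complex.slitPlane_ne_zero (doubleLoopRotated_mem_slitPlane t)
  apply Complex.ext <;> simp [doubleLoopRotated, h]

theorem convex_disc : Convex ℝ Disc := by
  rintro ⟨x, y⟩ hx ⟨z, w⟩ hz a b ha hb hab
  simp only [Disc, Set.mem_ofPred_eq, Prod.smul_mk, Prod.mk_add_mk, smul_eq_mul] at *
  obtain rfl : b = 1 - a := by linarith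
  nlinarith [mul_nonneg (mul_nonneg ha hb) (add_nonneg (sq_nonneg (x - z)) (sq_nonneg (y - w))),
    mul_le_mul_of_nonneg_left hx ha, mul_le_mul_of_nonneg_left hz hb]

theorem isCompact_disc : IsCompact Disc := by
  refine (isCompact_Icc (a := ((-1, -1) : ℝ × ℝ)) (b := (1, 1))).of_isClosed_subset
    (isClosed_le (by fun_prop) continuous_const) ?_
  rintro ⟨x, y⟩ h
  simp only [Disc, Set.mem_ofPred_eq] at h
  refine ⟨⟨?_, ?_⟩, ?_, ?_⟩ <;> simp only <;> nlinarith [sq_nonneg x, sq_nonneg y]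

/-- At a maximum over the disc of a function with nonvanishing differential, the point lies on
the boundary circle and the gradient is a positive multiple of the outward normal. -/
theorem exists_gradient_eq_smul_of_isMaxOn_disc {g : ℝ × ℝ → ℝ} {g' : ℝ × ℝ →L[ℝ] ℝ}
    {q : ℝ × ℝ} (hq : q ∈ Disc) (hmax : IsMaxOn g Disc q) (hg : HasFDerivAt g g' q)
    (hne : g' ≠ 0) :
    ∃ N t : ℝ, 0 < N ∧ q = (cos t, sin t) ∧ g' (1, 0) = N * cos t ∧ g' (0, 1) = N * sin t := by
  have hle (y : ℝ × ℝ) (hy : y ∈ Disc) : g' (y - q) ≤ 0 :=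
    hmax.localize.hasFDerivWithinAt_nonpos hg.hasFDerivWithinAt
      (sub_mem_posTangentConeAt_of_segment_subset (convex_disc.segment_subset hq hy))
  have happ (v : ℝ × ℝ) : g' v = g' (1, 0) * v.1 + g' (0, 1) * v.2 := by
    conv_lhs => rw [show v = v.1 • ((1, 0) : ℝ × ℝ) + v.2 • ((0, 1) : ℝ × ℝ) by ext <;> simp]
    simp only [map_add, map_smul, smul_eq_mul]
    ring
  set a := g' (1, 0)
  set b := g' (0, 1)
  have hab : 0 < a ^ 2 + b ^ 2 := by
    refine (by positivity : 0 ≤ a ^ 2 + b ^ 2).lt_of_ne' fun h => hne ?_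
    have ha : a = 0 := by nlinarith [sq_nonneg a, sq_nonneg b]
    have hb : b = 0 := by nlinarith [sq_nonneg a, sq_nonneg b]
    ext <;> simp [happ, ha, hb]
  set N := √(a ^ 2 + b ^ 2)
  have hN : 0 < N := sqrt_pos.2 hab
  have hN2 : N ^ 2 = a ^ 2 + b ^ 2 := sq_sqrt hab.le
  have hy := hle (a / N, b / N) (by
    simp only [Disc, Set.mem_ofPred_eq, div_pow, ← add_div, hN2]
    exact (div_self hab.ne').le)
  rw [happ] at hy
  simp only [Prod.fst_sub, Prod.snd_sub] at hy
  have hy' : N ≤ a * q.1 + b * q.2 := by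
    have : a * (a / N) + b * (b / N) = N := by
      field_simp
      linarith
    linarith
  have hq' : q.1 ^ 2 + q.2 ^ 2 ≤ 1 := hq
  have hsum : (a - N * q.1) ^ 2 + (b - N * q.2) ^ 2 ≤ 0 := by
    nlinarith [mul_le_mul_of_nonneg_left hq' (sq_nonneg N), mul_le_mul_of_nonneg_left hy' hN.le]
  have ha : a = N * q.1 := by nlinarith [sq_nonneg (a - N * q.1), sq_nonneg (b - N * q.2)]
  have hb : b = N * q.2 := by nlinarith [sq_nonneg (a - N * q.1), sq_nonneg (b - N * q.2)]
  have hq1 : q.1 ^ 2 + q.2 ^ 2 = 1 := by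
    rw [ha, hb] at hN2
    have : N ^ 2 * (q.1 ^ 2 + q.2 ^ 2 - 1) = 0 := by linarith
    have := (mul_eq_zero.1 this).resolve_left (by positivity)
    linarith
  set z : ℂ := ⟨q.1, q.2⟩
  have hz : ‖z‖ = 1 := by
    rw [Complex.norm_def, Complex.normSq_apply, sqrt_eq_one]
    linarith [hq1]
  have hcos : q.1 = cos z.arg := by simpa [hz, z] using (Complex.norm_mul_cos_arg z).symm
  have hsin : q.2 = sin z.arg := by simpa [hz, z] using (Complex.norm_mul_sin_arg z).symm
  exact ⟨N, z.arg, hN, Prod.ext hcos hsin, by rw [← hcos, ha], by rw [← hsin, hb]⟩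

/-- The Jacobian determinant of a map of the plane. -/
def planeJacobian (f : ℝ × ℝ → ℝ × ℝ) (q : ℝ × ℝ) : ℝ :=
  (fderiv ℝ f q (1, 0)).1 * (fderiv ℝ f q (0, 1)).2 -
    (fderiv ℝ f q (0, 1)).1 * (fderiv ℝ f q (1, 0)).2

theorem planeJacobian_ne_zero_of_injective {f : ℝ × ℝ → ℝ × ℝ} {q : ℝ × ℝ}
    (h : Injective (fderiv ℝ f q)) : planeJacobian f q ≠ 0 := by
  set L := fderiv ℝ f q with hL
  have happ (x y : ℝ) : L (x, y) = x • L (1, 0) + y • L (0, 1) := by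
    rw [← map_smul, ← map_smul, ← map_add]
    simp
  intro hJ
  simp only [planeJacobian, ← hL] at hJ
  have h₁ : L ((L (0, 1)).2, -(L (1, 0)).2) = 0 := by
    rw [happ]
    ext <;> simp only [Prod.fst_add, Prod.snd_add, Prod.smul_fst, Prod.smul_snd, smul_eq_mul,
      Prod.fst_zero, Prod.snd_zero] <;> linarith
  have h₂ : L ((L (0, 1)).1, -(L (1, 0)).1) = 0 := by
    rw [happ]
    ext <;> simp only [Prod.fst_add, Prod.snd_add, Prod.smul_fst, Prod.smul_snd, smul_eq_mul,
      Prod.fst_zero, Prod.snd_zero] <;> linarith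
  have h₁' := Prod.ext_iff.1 (h (h₁.trans (map_zero L).symm))
  have h₂' := Prod.ext_iff.1 (h (h₂.trans (map_zero L).symm))
  have h₀ : L (1, 0) = L 0 := by
    rw [map_zero]
    exact Prod.ext (neg_eq_zero.1 h₂'.2) (neg_eq_zero.1 h₁'.2)
  simpa using h h₀

/-- The horizontal differential of a local diffeomorphism of the plane does not vanish. -/
theorem smul_fst_comp_ne_zero_of_injective {L : ℝ × ℝ →L[ℝ] ℝ × ℝ} (h : Injective L) {k : ℝ}
    (hk : k ≠ 0) : k • (ContinuousLinearMap.fst ℝ ℝ ℝ).comp L ≠ 0 := by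
  intro h₀
  obtain ⟨v, hv⟩ := (LinearMap.injective_iff_surjective (f := L.toLinearMap)).1 h (1, 0)
  have h₁ := DFunLike.congr_fun h₀ v
  have hv' : L v = (1, 0) := hv
  simp [hv', hk] at h₁

/-- Where `k * x` is maximal on an immersed disc, the Jacobian has the sign of `k` times the
vertical velocity of the boundary curve. -/
theorem exists_planeJacobian_eq_of_isMaxOn {f : ℝ × ℝ → ℝ × ℝ} {γ γ' : ℝ → ℝ × ℝ}
    (hfd : ∀ q ∈ Disc, DifferentiableAt ℝ f q) (hinj : ∀ q ∈ Disc, Injective (fderiv ℝ f q))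
    (hb : ∀ t, f (cos t, sin t) = γ t) (hγ : ∀ t, HasDerivAt γ (γ' t) t) {k : ℝ} (hk : k ≠ 0) :
    ∃ N t : ℝ, 0 < N ∧ (cos t, sin t) ∈ Disc ∧ (∀ s, k * (γ s).1 ≤ k * (γ t).1) ∧
      k * planeJacobian f (cos t, sin t) = N * (γ' t).2 := by
  obtain ⟨q, hq, hmax⟩ := isCompact_disc.exists_isMaxOn ⟨(0, 0), by simp [Disc]⟩
    (f := fun p => k * (f p).1)
    (fun p hp => ((hfd p hp).continuousAt.fst.const_mul k).continuousWithinAt)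
  obtain ⟨N, t, hN, rfl, hx, hy⟩ := exists_gradient_eq_smul_of_isMaxOn_disc hq hmax
    ((hfd q hq).hasFDerivAt.fst.const_mul k) (smul_fst_comp_ne_zero_of_injective (hinj q hq) hk)
  refine ⟨N, t, hN, hq, fun s => ?_, ?_⟩
  · rw [← hb, ← hb]
    exact hmax (by simp [Disc] : (cos s, sin s) ∈ Disc)
  · have hder := (hfd _ hq).hasFDerivAt.comp_hasDerivAt t
      ((hasDerivAt_cos t).prodMk (hasDerivAt_sin t))
    have hγt := hγ t
    rw [show γ = f ∘ fun t => (cos t, sin t) from funext fun s => (hb s).symm] at hγt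
    rw [hγt.unique hder,
      show (-sin t, cos t) = -sin t • ((1, 0) : ℝ × ℝ) + cos t • ((0, 1) : ℝ × ℝ) by simp]
    simp only [smul_apply, ContinuousLinearMap.comp_apply,
      ContinuousLinearMap.coe_fst', smul_eq_mul] at hx hy
    simp only [map_add, map_smul, Prod.snd_add, Prod.smul_snd, smul_eq_mul, planeJacobian]
    linear_combination (fderiv ℝ f (cos t, sin t) (0, 1)).2 * hx -
      (fderiv ℝ f (cos t, sin t) (1, 0)).2 * hy

theorem not_extendsToDiscImmersion_doubleLoop : ¬ ExtendsToDiscImmersion doubleLoop := by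
  rintro ⟨f, U, hU, hDU, hf, hinj, hb⟩
  have hfd (q) (hq : q ∈ Disc) : DifferentiableAt ℝ f q :=
    (hf.differentiableOn one_ne_zero).differentiableAt (hU.mem_nhds (hDU hq))
  have hcont : ContinuousOn (planeJacobian f) Disc := by
    have h := (hf.continuousOn_fderiv_of_isOpen hU le_rfl).mono hDU
    unfold planeJacobian
    fun_prop
  obtain ⟨N, t, hN, ht, hmax, hJ⟩ := exists_planeJacobian_eq_of_isMaxOn hfd hinj hb
    hasDerivAt_doubleLoop (one_ne_zero (α := ℝ))
  obtain ⟨M, s, hM, hs, hmin, hK⟩ := exists_planeJacobian_eq_of_isMaxOn hfd hinj hb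
    hasDerivAt_doubleLoop (neg_ne_zero.2 (one_ne_zero (α := ℝ)))
  have hct : cos t = -1 / 4 := by
    have h := hmax (arccos (-1 / 4))
    simp only [doubleLoop] at h
    rw [cos_arccos (by norm_num) (by norm_num)] at h
    nlinarith
  have hcs : cos s = 1 := by
    have h := hmin 0
    simp only [doubleLoop, cos_zero] at h
    nlinarith [cos_le_one s, neg_one_le_cos s]
  have hpos : 0 < planeJacobian f (cos t, sin t) := by
    simp only [doubleLoopVelocity, hct] at hJ ⊢
    linarith
  have hneg : planeJacobian f (cos s, sin s) < 0 := by
    simp only [doubleLoopVelocity, hcs] at hK ⊢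
    linarith
  obtain ⟨q, hq, h₀⟩ := convex_disc.isPreconnected.intermediate_value hs ht hcont
    ⟨hneg.le, hpos.le⟩
  exact planeJacobian_ne_zero_of_injective (hinj q hq) h₀

/-- There is a smooth immersion `γ : S¹ → ℝ²` whose Gauss map has degree `1` but which
does not extend to an immersion of the closed disc `D² → ℝ²`: degree one of the Gauss map
is necessary but not sufficient for such an extension. -/
theorem exists_degree_one_immersion_not_extending :
    ∃ γ : ℝ → ℝ × ℝ, ContDiff ℝ (⊤ : ℕ∞) γ ∧ IsCircleImmersion γ ∧ GaussMapHasDegree γ 1 ∧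
      ¬ ExtendsToDiscImmersion γ := by
  exact ⟨doubleLoop, contDiff_doubleLoop,
    ⟨contDiff_doubleLoop, doubleLoop_periodic, deriv_doubleLoop_ne_zero⟩,
    gaussMapHasDegree_doubleLoop, not_extendsToDiscImmersion_doubleLoop⟩

end
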